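/- arXiv:1702.08245 — 2 statements merged into one kernel-verified Lean document; each statement's English description precedes it below -/
import Mathlib

section
/- With notation as in the degree theorem, the quantity N_r (the number of subspaces W' of V with dim W' = n−k+r and dim(W ∩ W') = r, for a fixed k-dimensional subspace W) satisfies N_r = q^{(n−k)(k−r)} · (q^k−1)(q^{k−1}−1)⋯(q^{k−r+1}−1) · (q^{n−k}−1)(q^{n−k−1}−1)⋯(q^{n−k−r+1}−1) / ∏ (appropriate cancellation), i.e., N_r is divisible by q^{(n−k)(k−r)}; in particular, if q is even then N_r is even for every 0 ≤ r ≤ k−1. -/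
open Module

namespace Submodule

section Ring

variable {R E : Type*} [Ring R] [AddCommGroup E] [Module R E]

/-- Projections onto `p` correspond to linear maps into `p` from a fixed complement of `p`. -/
noncomputable def projEquivOfIsCompl {p c : Submodule R E} (h : IsCompl p c) :
    {f : E →ₗ[R] p // ∀ x : p, f x = x} ≃ (c →ₗ[R] p) where
  toFun f := f.1.domRestrict c
  invFun g := ⟨LinearMap.ofIsCompl h LinearMap.id g, fun x ↦ by simp⟩
  left_inv f := Subtype.ext <| LinearMap.ofIsCompl_eq h (fun u ↦ (f.2 u).symm) fun _ ↦ rfl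
  right_inv g := by ext; simp

/-- Submodules meeting `W` exactly in `U` and spanning the whole module together with `W`
correspond to the complements of `W / U` in the quotient by `U`. -/
def infEqCodisjointEquiv {U W : Submodule R E} (hU : U ≤ W) :
    {W' : Submodule R E // W ⊓ W' = U ∧ Codisjoint W W'} ≃
      {q : Submodule R (E ⧸ U) // IsCompl (W.map U.mkQ) q} where
  toFun W' := ⟨(comapMkQRelIso U).symm ⟨W', W'.2.1.ge.trans inf_le_right⟩,
    (comapMkQRelIso U).symm.isCompl
      (x := ⟨W, hU⟩) (y := ⟨W', _⟩) (Set.Ici.isCompl_iff.2 W'.2)⟩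
  invFun q := ⟨comapMkQRelIso U q, by
    have h := Set.Ici.isCompl_iff.1 ((comapMkQRelIso U).isCompl q.2)
    rwa [show comapMkQRelIso U (W.map U.mkQ) = ⟨W, hU⟩ from
      (comapMkQRelIso U).apply_symm_apply ⟨W, hU⟩] at h⟩
  left_inv W' := Subtype.ext <| congrArg (fun x : Set.Ici U ↦ x.1) <|
    (comapMkQRelIso U).apply_symm_apply ⟨W', W'.2.1.ge.trans inf_le_right⟩
  right_inv q := Subtype.ext <| (comapMkQRelIso U).symm_apply_apply q

end Ring

variable {K V : Type*} [Field K] [AddCommGroup V] [Module K V] [FiniteDimensional K V]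

theorem natCard_isCompl (p : Submodule K V) :
    Nat.card {q // IsCompl p q} =
      Nat.card K ^ ((finrank K V - finrank K p) * finrank K p) := by
  obtain ⟨c, hc⟩ := p.exists_isCompl
  rw [Nat.card_congr (p.isComplEquivProj.trans (projEquivOfIsCompl hc)),
    Module.natCard_eq_pow_finrank (K := K), finrank_linearMap,
    ← finrank_add_eq_of_isCompl hc, Nat.add_sub_cancel_left]

theorem natCard_inf_eq_codisjoint {U W : Submodule K V} (hU : U ≤ W) :
    Nat.card {W' : Submodule K V // W ⊓ W' = U ∧ Codisjoint W W'} =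
      Nat.card K ^ ((finrank K V - finrank K W) * (finrank K W - finrank K U)) := by
  have h₁ := finrank_quotient_add_finrank U
  have h₂ : finrank K (W.map U.mkQ) + finrank K U = finrank K W := by
    have h := LinearMap.finrank_range_add_finrank_ker (U.mkQ.domRestrict W)
    rwa [LinearMap.range_domRestrict, LinearMap.ker_domRestrict, ker_mkQ,
      (comapSubtypeEquivOfLe hU).finrank_eq] at h
  rw [Nat.card_congr (infEqCodisjointEquiv hU), natCard_isCompl]
  congr 2 <;> omega

theorem codisjoint_iff_finrank_eq {W W' : Submodule K V} :
    Codisjoint W W' ↔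
      finrank K W + finrank K W' = finrank K V + finrank K ↥(W ⊓ W') := by
  rw [← finrank_sup_add_finrank_inf_eq W W', Nat.add_right_cancel_iff, codisjoint_iff]
  exact ⟨fun h ↦ by rw [h, finrank_top], eq_top_of_finrank_eq⟩

theorem pow_dvd_ncard_finrank_inf_eq [Finite K] (W : Submodule K V) (r : ℕ) :
    Nat.card K ^ ((finrank K V - finrank K W) * (finrank K W - r)) ∣
      Set.ncard {W' : Submodule K V |
        finrank K W' = finrank K V - finrank K W + r ∧ finrank K ↥(W ⊓ W') = r} := by
  classical
  have : Finite V := Module.finite_of_finite K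
  have : Fintype (Submodule K V) := Fintype.ofFinite _
  rw [Set.ncard_eq_toFinset_card', Finset.card_eq_sum_card_image (W ⊓ ·)]
  refine Finset.dvd_sum fun U hU ↦ dvd_of_eq ?_
  obtain ⟨hUW, hUr⟩ : U ≤ W ∧ finrank K U = r := by
    obtain ⟨W', hW', rfl⟩ := Finset.mem_image.1 hU
    exact ⟨inf_le_left, (Set.mem_toFinset.1 hW').2⟩
  rw [← hUr, ← natCard_inf_eq_codisjoint hUW, Nat.card_eq_fintype_card, Fintype.card_subtype]
  congr 1
  ext W'
  have hW := W.finrank_le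
  simp only [Finset.mem_filter, Finset.mem_univ, true_and, Set.mem_toFinset, Set.mem_ofPred_eq,
    codisjoint_iff_finrank_eq]
  constructor
  · rintro ⟨rfl, h⟩
    exact ⟨⟨by omega, rfl⟩, rfl⟩
  · rintro ⟨⟨h, -⟩, rfl⟩
    exact ⟨rfl, by omega⟩

end Submodule

/-- For a fixed `k`-dimensional subspace `W` of an `n`-dimensional space over a field
with `q` elements, the number `N_r` of subspaces `W'` with `dim W' = n−k+r` and
`dim (W ∩ W') = r` is divisible by `q^{(n−k)(k−r)}`; in particular, if `q` is even
then `N_r` is even for every `0 ≤ r ≤ k−1`. -/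
theorem N_r_divisible (K V : Type*) [Field K] [Fintype K] [AddCommGroup V]
    [Module K V] [FiniteDimensional K V] (n k r q : ℕ) (hq : Fintype.card K = q)
    (hn : 2 ≤ n) (hdim : finrank K V = n) (hk1 : 1 ≤ k) (hk2 : k ≤ n - 1)
    (hr : r ≤ k - 1) (W : Submodule K V) (hWk : finrank K W = k) :
    q ^ ((n - k) * (k - r)) ∣
      Set.ncard {W' : Submodule K V |
        finrank K W' = n - k + r ∧ finrank K ↥(W ⊓ W') = r} ∧
    (Even q → Even (Set.ncard {W' : Submodule K V |
        finrank K W' = n - k + r ∧ finrank K ↥(W ⊓ W') = r})) := by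
  have hdvd := W.pow_dvd_ncard_finrank_inf_eq r
  rw [Nat.card_eq_fintype_card, hq, hdim, hWk] at hdvd
  have hexp : (n - k) * (k - r) ≠ 0 := Nat.mul_ne_zero (by omega) (by omega)
  exact ⟨hdvd, fun h ↦ (h.pow_of_ne_zero hexp).trans_dvd hdvd⟩
end

section
/- Every vertex of G(V) has even degree if and only if q is even. (If q is even, all degrees are even, so G(V) is Eulerian; if q is odd, a one-dimensional subspace has odd degree q^{n−1}, so G(V) is not Eulerian.) -/
open Module

section Transvections

variable {K V : Type*} [Field K] [AddCommGroup V] [Module K V]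

/-- The unipotent endomorphism `x ↦ x + f [x]` of `V` attached to `f : V ⧸ W → W`. -/
def unipotentOfQuotient (W : Submodule K V) (f : (V ⧸ W) →ₗ[K] W) : V →ₗ[K] V :=
  LinearMap.id + W.subtype ∘ₗ f ∘ₗ W.mkQ

@[simp]
lemma unipotentOfQuotient_apply (W : Submodule K V) (f : (V ⧸ W) →ₗ[K] W) (x : V) :
    unipotentOfQuotient W f x = x + (f (W.mkQ x) : V) := rfl

lemma unipotentOfQuotient_zero (W : Submodule K V) :
    unipotentOfQuotient W 0 = LinearMap.id := by
  ext x; simp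

lemma unipotentOfQuotient_add (W : Submodule K V) (f g : (V ⧸ W) →ₗ[K] W) :
    unipotentOfQuotient W (f + g) = unipotentOfQuotient W f ∘ₗ unipotentOfQuotient W g := by
  ext x
  have h : W.mkQ ((g (W.mkQ x) : W) : V) = 0 := by simp
  simp only [LinearMap.comp_apply, unipotentOfQuotient_apply, map_add, h, map_zero,
    LinearMap.add_apply, Submodule.coe_add, ZeroMemClass.coe_zero, add_zero]
  abel

lemma map_unipotentOfQuotient_add (W W' : Submodule K V) (f g : (V ⧸ W) →ₗ[K] W) :
    W'.map (unipotentOfQuotient W (f + g)) =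
      (W'.map (unipotentOfQuotient W g)).map (unipotentOfQuotient W f) := by
  rw [unipotentOfQuotient_add, Submodule.map_comp]

lemma sup_map_unipotentOfQuotient (W W' : Submodule K V) (f : (V ⧸ W) →ₗ[K] W) :
    W ⊔ W'.map (unipotentOfQuotient W f) = W ⊔ W' := by
  have key : ∀ (U : Submodule K V) (g : (V ⧸ W) →ₗ[K] W),
      W ⊔ U.map (unipotentOfQuotient W g) ≤ W ⊔ U := by
    intro U g
    refine sup_le le_sup_left ?_
    rintro _ ⟨x, hx, rfl⟩
    rw [unipotentOfQuotient_apply]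
    exact add_mem (Submodule.mem_sup_right hx) (Submodule.mem_sup_left (Subtype.prop _))
  refine le_antisymm (key W' f) ?_
  have h := key (W'.map (unipotentOfQuotient W f)) (-f)
  rwa [← map_unipotentOfQuotient_add, neg_add_cancel, unipotentOfQuotient_zero,
    Submodule.map_id] at h

/-- The proper subspaces of `V` that span `V` together with `W`. -/
abbrev ProperSupplement (W : Submodule K V) : Type _ :=
  {W' : Submodule K V // W' ≠ ⊤ ∧ W ⊔ W' = ⊤}

/-- `Hom(V ⧸ W, W)` acts by unipotent maps on the proper subspaces `W'` with `W + W' = V`. -/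
instance unipotentAction (W : Submodule K V) :
    MulAction (Multiplicative ((V ⧸ W) →ₗ[K] W)) (ProperSupplement W) where
  smul f W' := ⟨W'.1.map (unipotentOfQuotient W f.toAdd), by
    refine ⟨fun h => W'.2.1 ?_, by rw [sup_map_unipotentOfQuotient, W'.2.2]⟩
    have hc : ∀ g, (⊤ : Submodule K V).map (unipotentOfQuotient W g) = ⊤ := fun g => by
      rw [Submodule.map_top, LinearMap.range_eq_top]
      intro x
      refine ⟨unipotentOfQuotient W (-g) x, ?_⟩
      rw [← LinearMap.comp_apply, ← unipotentOfQuotient_add, add_neg_cancel,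
        unipotentOfQuotient_zero, LinearMap.id_apply]
    have hinv := map_unipotentOfQuotient_add W W'.1 (-f.toAdd) f.toAdd
    rwa [h, hc, neg_add_cancel, unipotentOfQuotient_zero, Submodule.map_id] at hinv⟩
  one_smul W' := Subtype.ext <| by
    change W'.1.map (unipotentOfQuotient W 0) = W'.1
    rw [unipotentOfQuotient_zero, Submodule.map_id]
  mul_smul f g W' := Subtype.ext <|
    map_unipotentOfQuotient_add W W'.1 f.toAdd g.toAdd

lemma coe_unipotentAction_smul (W : Submodule K V) (f : Multiplicative ((V ⧸ W) →ₗ[K] W))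
    (W' : ProperSupplement W) :
    (f • W').1 = W'.1.map (unipotentOfQuotient W f.toAdd) := rfl

lemma isEmpty_fixedPoints_unipotentAction {W : Submodule K V} (hW : W ≠ ⊤) :
    IsEmpty (MulAction.fixedPoints (Multiplicative ((V ⧸ W) →ₗ[K] W))
      (ProperSupplement W)) := by
  refine ⟨fun ⟨⟨W', hne, hsup⟩, hfix⟩ => hne ?_⟩
  suffices W ≤ W' by rwa [sup_eq_right.2 this] at hsup
  obtain ⟨v, hv⟩ : ∃ v, v ∉ W := by
    by_contra! h
    exact hW (eq_top_iff.2 fun x _ => h x)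
  obtain ⟨a, ha, w', hw', rfl⟩ := Submodule.mem_sup.1 (hsup ▸ Submodule.mem_top : v ∈ W ⊔ W')
  have hw : W.mkQ w' ≠ 0 := fun h =>
    hv (add_mem ha (by simpa using h))
  intro w hwW
  obtain ⟨f, hf⟩ := Module.Projective.exists_dual_eq_one K hw
  have h := congrArg Subtype.val (hfix (.ofAdd (f.smulRight (⟨w, hwW⟩ : W))))
  rw [coe_unipotentAction_smul] at h
  have hmem : w' + w ∈ W' := by
    rw [← show _ = W' from h]
    refine ⟨w', hw', ?_⟩
    rw [unipotentOfQuotient_apply, toAdd_ofAdd, LinearMap.smulRight_apply, hf, one_smul]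
  simpa using sub_mem hmem hw'

lemma even_card_properSupplement [Finite V] [CharP K 2] {W : Submodule K V} (hW : W ≠ ⊤) :
    Even (Nat.card (ProperSupplement W)) := by
  have hp : IsPGroup 2 (Multiplicative ((V ⧸ W) →ₗ[K] W)) := fun f => by
    refine ⟨1, Multiplicative.toAdd.injective ?_⟩
    rw [pow_one, toAdd_pow, toAdd_one, ← Nat.cast_smul_eq_nsmul K, CharP.cast_eq_zero, zero_smul]
  have := isEmpty_fixedPoints_unipotentAction hW
  have h := hp.card_modEq_card_fixedPoints (ProperSupplement W)
  rw [Nat.card_of_isEmpty (α := MulAction.fixedPoints _ _)] at h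
  exact even_iff_two_dvd.2 (Nat.modEq_zero_iff_dvd.1 h)

end Transvections

/-- Over a finite field of odd order, every subspace has an odd number of complements. -/
lemma odd_card_isCompl {K V : Type*} [Field K] [Finite K] [AddCommGroup V] [Module K V]
    [FiniteDimensional K V] (hK : Odd (Nat.card K)) (W : Submodule K V) :
    Odd (Nat.card {W' : Submodule K V // IsCompl W W'}) := by
  obtain ⟨C, hC⟩ := W.exists_isCompl
  let g := W.isComplEquivProj ⟨C, hC⟩
  let e : {f : V →ₗ[K] W // ∀ x : W, f x = x} ≃ LinearMap.ker (LinearMap.domRestrict' W :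
      (V →ₗ[K] W) →ₗ[K] (W →ₗ[K] W)) :=
    (Equiv.subRight g.1).subtypeEquiv fun f => by
      rw [LinearMap.mem_ker, LinearMap.ext_iff]
      refine forall_congr' fun x => ?_
      simp [g.2 x, sub_eq_zero]
  rw [Nat.card_congr (W.isComplEquivProj.trans e), Module.natCard_eq_pow_finrank (K := K)]
  exact hK.pow

/-- Every vertex of `G(V)` has even degree if and only if `q`, the size of the base
field, is even. (So `G(V)` is Eulerian iff `q` is even.) -/
theorem all_degrees_even_iff_q_even (K V : Type*) [Field K] [Fintype K] [AddCommGroup V]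
    [Module K V] [FiniteDimensional K V] (n : ℕ) (hn : 2 ≤ n) (hdim : finrank K V = n) :
    (∀ W : Submodule K V, W ≠ ⊥ → W ≠ ⊤ →
      Even (Set.ncard {W' : Submodule K V | W' ≠ ⊥ ∧ W' ≠ ⊤ ∧ W ⊔ W' = ⊤})) ↔
    Even (Fintype.card K) := by
  constructor
  · intro h
    by_contra hodd
    rw [Nat.not_even_iff_odd, ← Nat.card_eq_fintype_card] at hodd
    have : Nontrivial V := Module.nontrivial_of_finrank_pos (R := K) (by omega)
    obtain ⟨v, hv⟩ := exists_ne (0 : V)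
    have hatom : IsAtom (Submodule.span K {v}) := nonzero_span_atom v hv
    have htop : Submodule.span K {v} ≠ ⊤ := fun ht => by
      have h1 := finrank_span_singleton (K := K) hv
      rw [ht, finrank_top] at h1
      omega
    have hset : {W' : Submodule K V | W' ≠ ⊥ ∧ W' ≠ ⊤ ∧ Submodule.span K {v} ⊔ W' = ⊤} =
        {W' | IsCompl (Submodule.span K {v}) W'} := by
      ext W'
      constructor
      · rintro ⟨-, hne, hsup⟩
        refine ⟨(IsAtom.not_le_iff_disjoint hatom).1 fun hle => hne ?_, codisjoint_iff.2 hsup⟩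
        rwa [sup_eq_right.2 hle] at hsup
      · intro hc
        refine ⟨?_, ?_, hc.sup_eq_top⟩
        · rintro rfl
          exact htop (by simpa using hc.sup_eq_top)
        · rintro rfl
          exact hatom.1 (by simpa using hc.inf_eq_bot)
    have heven := h _ hatom.1 htop
    rw [hset] at heven
    exact Nat.not_even_iff_odd.2 (odd_card_isCompl hodd (Submodule.span K {v})) heven
  · intro hq W _ hW
    have : CharP K 2 :=
      ringChar.of_eq (FiniteField.even_card_iff_char_two.2 (Nat.even_iff.1 hq))
    have : Finite V := Module.finite_of_finite K
    have hset : {W' : Submodule K V | W' ≠ ⊥ ∧ W' ≠ ⊤ ∧ W ⊔ W' = ⊤} =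
        {W' | W' ≠ ⊤ ∧ W ⊔ W' = ⊤} := by
      ext W'
      refine ⟨And.right, fun h => ⟨?_, h⟩⟩
      rintro rfl
      exact hW (by simpa using h.2)
    rw [hset]
    exact even_card_properSupplement hW
end
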